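/- arXiv:1606.07594 — 3 statements merged into one kernel-verified Lean document; each statement's English description precedes it below -/
import Mathlib

section
/- Let w = z_{k₁l₁}⋯z_{k_sl_s} (s ≥ 1) be a product of words z_{ij}, and let w̄ be the associated composite partial bijection. If i, j ∈ {1,…,n} are distinct and both lie in the domain of w̄, then t_{ij} w ~ w t_{w̄(i), w̄(j)}. -/
namespace PaperFormal

/-- The alphabet `X`: letters `e_r` for `r ∈ {1,…,n}` (modelled as `Fin n`) and
letters `t_{ij} = t_{ji}` for distinct `i,j`, modelled as unordered pairs. -/
abbrev XA (n : ℕ) := Fin n ⊕ Sym2 (Fin n)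

/-- The word consisting of the single letter `e_r`. -/
def E {n : ℕ} (r : Fin n) : FreeMonoid (XA n) := FreeMonoid.of (Sum.inl r)

/-- The word consisting of the single letter `t_{ij} = t_{ji}`. -/
def T {n : ℕ} (i j : Fin n) : FreeMonoid (XA n) := FreeMonoid.of (Sum.inr s(i, j))

/-- The defining relations (R1)–(R10). -/
inductive XRel {n : ℕ} : FreeMonoid (XA n) → FreeMonoid (XA n) → Prop
  | r1 (i : Fin n) : XRel (E i * E i) (E i)
  | r2 (i j : Fin n) (h : i ≠ j) : XRel (E i * E j) (E j * E i)
  | r3 (i j : Fin n) (h : i ≠ j) : XRel (T i j * T i j) (T i j)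
  | r4 (i j k l : Fin n) (hij : i ≠ j) (hkl : k ≠ l) : XRel (T i j * T k l) (T k l * T i j)
  | r5 (i j k : Fin n) (hij : i ≠ j) (hjk : j ≠ k) (hik : i ≠ k) :
      XRel (T i j * T j k) (T j k * T k i)
  | r6 (i j k : Fin n) (hij : i ≠ j) (hki : k ≠ i) (hkj : k ≠ j) :
      XRel (T i j * E k) (E k * T i j)
  | r7 (i j k : Fin n) (hij : i ≠ j) (h : k = i ∨ k = j) : XRel (T i j * E k * T i j) (T i j)
  | r8 (i j k : Fin n) (hij : i ≠ j) (h : k = i ∨ k = j) : XRel (E k * T i j * E k) (E k)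
  | r9 (i j k : Fin n) (hij : i ≠ j) (hjk : j ≠ k) (hik : i ≠ k) :
      XRel (E k * T k i * E i * T i j * E j * T j k * E k)
           (E k * T k j * E j * T j i * E i * T i k * E k)
  | r10 (i j k l : Fin n) (hij : i ≠ j) (hik : i ≠ k) (hil : i ≠ l) (hjk : j ≠ k)
      (hjl : j ≠ l) (hkl : k ≠ l) :
      XRel (E k * T k i * E i * T i j * E j * T j l * E l * T l k * E k)
           (E k * T k l * E l * T l i * E i * T i j * E j * T j k * E k)

/-- The congruence `~` on the free monoid `X*` generated by relations (R1)–(R10). -/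
def xcon (n : ℕ) : Con (FreeMonoid (XA n)) := conGen XRel

/-- The word `z_{ij} = e_i t_{ij} e_j`. -/
def Z {n : ℕ} (i j : Fin n) : FreeMonoid (XA n) := E i * T i j * E j

/-- The partial bijection `f̄_{ij}`: domain `{1,…,n}∖{i}`, maps `j` to `i`, fixes other points. -/
def fbar {n : ℕ} (i j : Fin n) (x : Fin n) : Option (Fin n) :=
  if x = i then none else if x = j then some i else some x

/-- The composite partial bijection `ū` associated to `u = z_{i₁j₁}⋯z_{i_sj_s}`
(applying `f̄_{i₁j₁}` first). -/
def pcomp {n : ℕ} (L : List (Fin n × Fin n)) (x : Fin n) : Option (Fin n) :=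
  L.foldl (fun o p => o.bind (fbar p.1 p.2)) (some x)

/-- The word `z_{i₁j₁}⋯z_{i_sj_s}`. -/
def zprod {n : ℕ} (L : List (Fin n × Fin n)) : FreeMonoid (XA n) :=
  (L.map fun p => Z p.1 p.2).prod

/-- The word `t_{i₁j₁}⋯t_{i_sj_s}`. -/
def tprod {n : ℕ} (L : List (Fin n × Fin n)) : FreeMonoid (XA n) :=
  (L.map fun p => T p.1 p.2).prod

lemma T_symm {n : ℕ} (i j : Fin n) : T i j = T j i := by
  simp only [T, Sym2.eq_swap]

lemma xcon_coe_eq {n : ℕ} {u v : FreeMonoid (XA n)} (h : XRel u v) :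
    (u : (xcon n).Quotient) = v :=
  (Con.eq _).2 (ConGen.Rel.of _ _ h)

lemma pcomp_cons {n : ℕ} (p : Fin n × Fin n) (L : List (Fin n × Fin n)) {x y : Fin n}
    (h : fbar p.1 p.2 x = some y) : pcomp (p :: L) x = pcomp L y := by
  simp [pcomp, h]

lemma exists_fbar_of_pcomp_cons {n : ℕ} {p : Fin n × Fin n} {L : List (Fin n × Fin n)}
    {x y : Fin n} (h : pcomp (p :: L) x = some y) : ∃ z, fbar p.1 p.2 x = some z := by
  rcases hz : fbar p.1 p.2 x with _ | z
  · have key : ∀ M : List (Fin n × Fin n),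
        M.foldl (fun o p => o.bind (fbar p.1 p.2)) none = none := by
      intro M
      induction M with
      | nil => rfl
      | cons q M ih => simpa using ih
    simp [pcomp, hz, key] at h
  · exact ⟨z, rfl⟩

lemma fbar_ne {n : ℕ} {a b i j i' j' : Fin n} (hij : i ≠ j)
    (hi : fbar a b i = some i') (hj : fbar a b j = some j') : i' ≠ j' := by
  grind [fbar]

/-- Moving `t_{ij}` through `z_{ab}` when neither `i` nor `j` meets `{a, b}`. -/
lemma T_mul_Z_of_disjoint {n : ℕ} {a b i j : Fin n} (hab : a ≠ b) (hij : i ≠ j)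
    (hia : i ≠ a) (hib : i ≠ b) (hja : j ≠ a) (hjb : j ≠ b) :
    ((T i j * Z a b : FreeMonoid (XA n)) : (xcon n).Quotient) = (Z a b * T i j : _) := by
  have h1 := xcon_coe_eq (XRel.r6 i j a hij hia.symm hja.symm)
  have h2 := xcon_coe_eq (XRel.r4 i j a b hij hab)
  have h3 := xcon_coe_eq (XRel.r6 i j b hij hib.symm hjb.symm)
  simp only [Z, Con.coe_mul] at *
  rw [← mul_assoc, ← mul_assoc, h1, mul_assoc (E a : (xcon n).Quotient), h2, ← mul_assoc,
    mul_assoc _ _ (E b : (xcon n).Quotient), h3, ← mul_assoc]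

/-- Moving `t_{bj}` through `z_{ab}` turns it into `t_{aj}`. -/
lemma T_mul_Z_right {n : ℕ} {a b j : Fin n} (hab : a ≠ b) (hja : j ≠ a) (hjb : j ≠ b) :
    ((T b j * Z a b : FreeMonoid (XA n)) : (xcon n).Quotient) = (Z a b * T a j : _) := by
  have h1 := xcon_coe_eq (XRel.r6 b j a hjb.symm hab hja.symm)
  have h2 := xcon_coe_eq (XRel.r5 j b a hjb hab.symm hja)
  have h3 := xcon_coe_eq (XRel.r6 a j b hja.symm hab.symm hjb.symm)
  rw [T_symm j b, T_symm b a] at h2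
  simp only [Z, Con.coe_mul] at *
  rw [← mul_assoc, ← mul_assoc, h1, mul_assoc (E a : (xcon n).Quotient), h2, ← mul_assoc,
    mul_assoc _ _ (E b : (xcon n).Quotient), h3, ← mul_assoc]

lemma T_mul_Z {n : ℕ} {a b i j i' j' : Fin n} (hab : a ≠ b) (hij : i ≠ j)
    (hi : fbar a b i = some i') (hj : fbar a b j = some j') :
    ((T i j * Z a b : FreeMonoid (XA n)) : (xcon n).Quotient) = (Z a b * T i' j' : _) := by
  have hia : i ≠ a := by rintro rfl; simp [fbar] at hi
  have hja : j ≠ a := by rintro rfl; simp [fbar] at hj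
  simp only [fbar, if_neg hia, if_neg hja] at hi hj
  by_cases hib : i = b
  · subst hib
    rw [if_pos rfl, Option.some_inj] at hi
    rw [if_neg hij.symm, Option.some_inj] at hj
    subst hi hj
    exact T_mul_Z_right hab hja hij.symm
  rw [if_neg hib, Option.some_inj] at hi
  subst hi
  by_cases hjb : j = b
  · subst hjb
    rw [if_pos rfl, Option.some_inj] at hj
    subst hj
    rw [T_symm i j, T_symm i a]
    exact T_mul_Z_right hab hia hij
  · rw [if_neg hjb, Option.some_inj] at hj
    subst hj
    exact T_mul_Z_of_disjoint hab hij hia hib hja hjb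

lemma T_mul_zprod {n : ℕ} (L : List (Fin n × Fin n)) (hLd : ∀ p ∈ L, p.1 ≠ p.2)
    {i j i' j' : Fin n} (hij : i ≠ j) (hi : pcomp L i = some i') (hj : pcomp L j = some j') :
    ((T i j * zprod L : FreeMonoid (XA n)) : (xcon n).Quotient) = (zprod L * T i' j' : _) := by
  induction L generalizing i j with
  | nil =>
    simp only [pcomp, List.foldl_nil, Option.some_inj] at hi hj
    subst hi hj
    simp [zprod]
  | cons p L ih =>
    obtain ⟨k, hk⟩ := exists_fbar_of_pcomp_cons hi
    obtain ⟨l, hl⟩ := exists_fbar_of_pcomp_cons hj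
    rw [pcomp_cons p L hk] at hi
    rw [pcomp_cons p L hl] at hj
    have hz := T_mul_Z (hLd p List.mem_cons_self) hij hk hl
    have ht := ih (fun q hq => hLd q (List.mem_cons_of_mem p hq)) (fbar_ne hij hk hl) hi hj
    have hc : zprod (p :: L) = Z p.1 p.2 * zprod L := by simp [zprod]
    simp only [hc, Con.coe_mul] at *
    rw [← mul_assoc, hz, mul_assoc, ht, mul_assoc]

/-- Corollary twwt: if `w = z_{k₁l₁}⋯z_{k_sl_s}` (with `s ≥ 1`) and
`i ≠ j` both lie in the domain of the composite partial bijection `w̄`, then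
`t_{ij} w ~ w t_{w̄(i), w̄(j)}`. -/
theorem stmt6 (n : ℕ) (hn : 2 ≤ n) (L : List (Fin n × Fin n)) (hL : L ≠ [])
    (hLd : ∀ p ∈ L, p.1 ≠ p.2) (i j : Fin n) (hij : i ≠ j) (i' j' : Fin n)
    (hi : pcomp L i = some i') (hj : pcomp L j = some j') :
    xcon n (T i j * zprod L) (zprod L * T i' j') :=
  (Con.eq _).1 (T_mul_zprod L hLd hij hi hj)
end PaperFormal
end

section
/- Let u = z_{i₁j₁}⋯z_{i_sj_s} and v = z_{k₁l₁}⋯z_{k_tl_t} (with s, t ≥ 1) be products of words z_{ij}. If the composite partial bijections ū and v̄ are equal, then u ~ v. -/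
namespace PaperFormal

open Equiv (swap)

/-- The class of `e_i` in the quotient monoid. -/
def e {n : ℕ} (i : Fin n) : (xcon n).Quotient := (E i : FreeMonoid (XA n))

/-- The class of `z_{ij}` in the quotient monoid. -/
def z {n : ℕ} (i j : Fin n) : (xcon n).Quotient := (Z i j : FreeMonoid (XA n))

variable {n : ℕ}

lemma xcon_of_xRel {a b : FreeMonoid (XA n)} (h : XRel a b) :
    (a : (xcon n).Quotient) = b :=
  (Con.eq _).2 (ConGen.Rel.of _ _ h)

/-- The class of `t_{ij}` in the quotient monoid. -/
def t (i j : Fin n) : (xcon n).Quotient := (T i j : FreeMonoid (XA n))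

lemma t_symm (i j : Fin n) : t i j = t j i := by
  simp only [t, T, Sym2.eq_swap]

lemma z_eq (i j : Fin n) : z i j = e i * t i j * e j := rfl

lemma e_mul_self (i : Fin n) : e i * e i = e i := xcon_of_xRel (.r1 i)

lemma e_mul_self_assoc (i : Fin n) (x : (xcon n).Quotient) : e i * (e i * x) = e i * x := by
  rw [← mul_assoc, e_mul_self]

lemma e_comm (i j : Fin n) : e i * e j = e j * e i := by
  rcases eq_or_ne i j with rfl | h
  · rfl
  · exact xcon_of_xRel (.r2 i j h)

lemma e_t_e {i j k : Fin n} (hij : i ≠ j) (h : k = i ∨ k = j) : e k * t i j * e k = e k :=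
  xcon_of_xRel (.r8 i j k hij h)

lemma t_e_t {i j k : Fin n} (hij : i ≠ j) (h : k = i ∨ k = j) :
    t i j * e k * t i j = t i j :=
  xcon_of_xRel (.r7 i j k hij h)

lemma t_e_comm {i j k : Fin n} (hij : i ≠ j) (hi : k ≠ i) (hj : k ≠ j) :
    t i j * e k = e k * t i j :=
  xcon_of_xRel (.r6 i j k hij hi hj)

lemma e_z (i j : Fin n) : e i * z i j = z i j := by
  simp only [z_eq, ← mul_assoc, e_mul_self]

lemma e_z_assoc (i j : Fin n) (x : (xcon n).Quotient) : e i * (z i j * x) = z i j * x := by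
  rw [← mul_assoc, e_z]

lemma z_e (i j : Fin n) : z i j * e j = z i j := by
  simp only [z_eq, mul_assoc, e_mul_self]

lemma z_e_assoc (i j : Fin n) (x : (xcon n).Quotient) : z i j * (e j * x) = z i j * x := by
  rw [← mul_assoc, z_e]

lemma z_z {i j : Fin n} (h : i ≠ j) : z i j * z j i = e i := by
  calc z i j * z j i = e i * (t i j * (e j * e j) * t j i) * e i := by
        simp only [z_eq, mul_assoc]
    _ = e i := by rw [e_mul_self, t_symm j i, t_e_t h (.inr rfl), e_t_e h (.inl rfl)]

lemma z_z_assoc {i j : Fin n} (h : i ≠ j) (x : (xcon n).Quotient) :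
    z i j * (z j i * x) = e i * x := by
  rw [← mul_assoc, z_z h]

lemma e_mul_z_right {i j : Fin n} (h : i ≠ j) : e j * z i j = e i * e j := by
  rw [z_eq, mul_assoc, ← mul_assoc, e_comm j i, mul_assoc, ← mul_assoc (e j),
    e_t_e h (.inr rfl)]

lemma z_mul_e_left {i j : Fin n} (h : i ≠ j) : z i j * e i = e i * e j := by
  rw [z_eq, mul_assoc, e_comm j i, ← mul_assoc, e_t_e h (.inl rfl)]

lemma e_mul_z {i j : Fin n} (h : i ≠ j) (l : Fin n) :
    e l * z i j = z i j * e (swap i j l) := by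
  rcases eq_or_ne l i with rfl | hi
  · rw [Equiv.swap_apply_left, e_z, z_e]
  rcases eq_or_ne l j with rfl | hj
  · rw [Equiv.swap_apply_right, e_mul_z_right h, z_mul_e_left h]
  rw [Equiv.swap_apply_of_ne_of_ne hi hj, z_eq, mul_assoc, mul_assoc, mul_assoc, e_comm j l,
    ← mul_assoc (t i j), t_e_comm h hi hj, ← mul_assoc, ← mul_assoc, e_comm l i]
  simp only [mul_assoc]

lemma z_triangle {i j k : Fin n} (hij : i ≠ j) (hjk : j ≠ k) (hik : i ≠ k) :
    z k i * (z i j * z j k) = z k j * (z j i * z i k) := by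
  have h : e k * t k i * e i * t i j * e j * t j k * e k =
      e k * t k j * e j * t j i * e i * t i k * e k := xcon_of_xRel (.r9 i j k hij hjk hik)
  simpa only [z_eq, mul_assoc, e_mul_self_assoc] using h

lemma z_square {i j k l : Fin n} (hij : i ≠ j) (hik : i ≠ k) (hil : i ≠ l) (hjk : j ≠ k)
    (hjl : j ≠ l) (hkl : k ≠ l) :
    z k i * (z i j * (z j l * z l k)) = z k l * (z l i * (z i j * z j k)) := by
  have h : e k * t k i * e i * t i j * e j * t j l * e l * t l k * e k =
      e k * t k l * e l * t l i * e i * t i j * e j * t j k * e k :=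
    xcon_of_xRel (.r10 i j k l hij hik hil hjk hjl hkl)
  simpa only [z_eq, mul_assoc, e_mul_self_assoc] using h

/-- The element of the quotient monoid that represents the transposition `(i j)` restricted to
the complement of `k`. -/
def swapAt (k i j : Fin n) : (xcon n).Quotient :=
  if i = j then e k else if k = i then z i j else if k = j then z j i else
    z k i * (z i j * z j k)

@[simp] lemma swapAt_self (k i : Fin n) : swapAt k i i = e k := by simp [swapAt]

lemma swapAt_left {i j : Fin n} (h : i ≠ j) : swapAt i i j = z i j := by simp [swapAt, h]

lemma swapAt_right {i j : Fin n} (h : i ≠ j) : swapAt j i j = z j i := by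
  simp [swapAt, h, h.symm]

lemma swapAt_of_ne {i j k : Fin n} (h : i ≠ j) (hi : k ≠ i) (hj : k ≠ j) :
    swapAt k i j = z k i * (z i j * z j k) := by simp [swapAt, h, hi, hj]

lemma swapAt_comm (k i j : Fin n) : swapAt k i j = swapAt k j i := by
  rcases eq_or_ne i j with rfl | h
  · rfl
  rcases eq_or_ne k i with rfl | hi
  · rw [swapAt_left h, swapAt_right h.symm]
  rcases eq_or_ne k j with rfl | hj
  · rw [swapAt_left h.symm, swapAt_right h]
  rw [swapAt_of_ne h hi hj, swapAt_of_ne h.symm hj hi, z_triangle h hj.symm hi.symm]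

lemma e_swapAt (k i j : Fin n) : e k * swapAt k i j = swapAt k i j := by
  unfold swapAt
  split_ifs with h hi hj
  · exact e_mul_self k
  · rw [hi, e_z]
  · rw [hj, e_z]
  · exact e_z_assoc _ _ _

lemma e_mul_swapAt (l k i j : Fin n) :
    e l * swapAt k i j = swapAt k i j * e (swap i j l) := by
  unfold swapAt
  split_ifs with h hi hj
  · subst h
    rw [Equiv.swap_self, Equiv.refl_apply, e_comm]
  · exact e_mul_z h l
  · rw [e_mul_z (Ne.symm h), Equiv.swap_comm]
  · rw [← mul_assoc, e_mul_z hi, mul_assoc, ← mul_assoc (e _), e_mul_z h, mul_assoc, e_mul_z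
      (Ne.symm hj)]
    have : swap j k (swap i j (swap k i l)) = swap i j l := by
      simp only [Equiv.swap_apply_def]
      grind
    rw [this]
    simp only [mul_assoc]

lemma swapAt_e (k i j : Fin n) : swapAt k i j * e (swap i j k) = swapAt k i j := by
  rw [← e_mul_swapAt, e_swapAt]

lemma swapAt_conj {i j k l : Fin n} (hij : i ≠ j) (hik : i ≠ k) (hil : i ≠ l) (hjk : j ≠ k)
    (hjl : j ≠ l) (hkl : k ≠ l) :
    z k l * (swapAt l i j * z l k) = swapAt k i j := by
  rw [swapAt_of_ne hij hil.symm hjl.symm, swapAt_of_ne hij hik.symm hjk.symm]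
  calc z k l * (z l i * (z i j * z j l) * z l k)
      = (z k l * (z l i * (z i j * z j k))) * (z k j * (z j l * z l k)) := by
        simp only [mul_assoc, z_z_assoc hjk, e_z_assoc]
    _ = z k i * (z i j * z j k) := by
        rw [← z_square hij hik hil hjk hjl hkl, z_triangle hjl hkl.symm hjk]
        simp only [mul_assoc, z_z_assoc hkl.symm, e_z_assoc, z_z_assoc hjl, z_e_assoc]

lemma e_mul_swapAt_left {i j l : Fin n} (hij : i ≠ j) (hil : i ≠ l) (hjl : j ≠ l) :
    e l * swapAt i i j = e i * swapAt l i j := by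
  rw [swapAt_left hij, swapAt_of_ne hij hil.symm hjl.symm, ← mul_assoc (e i),
    e_mul_z_right hil.symm, mul_assoc, e_z_assoc, ← mul_assoc, e_mul_z hij,
    Equiv.swap_apply_of_ne_of_ne hil.symm hjl.symm, mul_assoc, e_mul_z_right hjl,
    ← mul_assoc, z_e]

lemma e_mul_swapAt_exchange (k l i j : Fin n) :
    e l * swapAt k i j = e k * swapAt l i j := by
  have left : ∀ {i j l : Fin n}, i ≠ j → e l * swapAt i i j = e i * swapAt l i j := by
    intro i j l hij
    rcases eq_or_ne i l with rfl | hil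
    · rfl
    rcases eq_or_ne j l with rfl | hjl
    · rw [swapAt_left hij, swapAt_right hij, e_mul_z_right hij, e_mul_z_right hij.symm, e_comm]
    exact e_mul_swapAt_left hij hil hjl
  rcases eq_or_ne i j with rfl | hij
  · simp [e_comm]
  rcases eq_or_ne i k with rfl | hik
  · exact left hij
  rcases eq_or_ne i l with rfl | hil
  · exact (left hij).symm
  rcases eq_or_ne j k with rfl | hjk
  · rw [swapAt_comm _ i, swapAt_comm _ i, left hij.symm]
  rcases eq_or_ne j l with rfl | hjl
  · rw [swapAt_comm _ i, swapAt_comm _ i, left hij.symm]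
  rcases eq_or_ne k l with rfl | hkl
  · rfl
  rw [← swapAt_conj hij hik hil hjk hjl hkl, ← mul_assoc, e_mul_z_right hkl, mul_assoc,
    ← mul_assoc (e l), e_swapAt, ← mul_assoc, e_mul_swapAt,
    Equiv.swap_apply_of_ne_of_ne hik.symm hjk.symm, mul_assoc, e_mul_z_right hkl.symm,
    ← mul_assoc]
  have hl : swapAt l i j * e l = swapAt l i j := by
    simpa [Equiv.swap_apply_of_ne_of_ne hil.symm hjl.symm] using swapAt_e l i j
  rw [hl]

/-- The product of the transpositions in a list, applying the first one first. -/
def act : List (Fin n × Fin n) → Fin n → Fin n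
  | [], x => x
  | p :: L, x => act L (swap p.1 p.2 x)

/-- The element of the quotient monoid that represents the product of a list of transpositions
restricted to the complement of `k`. -/
def actAt : Fin n → List (Fin n × Fin n) → (xcon n).Quotient
  | k, [] => e k
  | k, p :: L => swapAt k p.1 p.2 * actAt (swap p.1 p.2 k) L

lemma act_append (L M : List (Fin n × Fin n)) (x : Fin n) :
    act (L ++ M) x = act M (act L x) := by
  induction L generalizing x with
  | nil => rfl
  | cons p L ih => exact ih _

lemma e_actAt (k : Fin n) (L : List (Fin n × Fin n)) : e k * actAt k L = actAt k L := by
  cases L with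
  | nil => exact e_mul_self k
  | cons p L => rw [actAt, ← mul_assoc, e_swapAt]

lemma actAt_append (k : Fin n) (L M : List (Fin n × Fin n)) :
    actAt k (L ++ M) = actAt k L * actAt (act L k) M := by
  induction L generalizing k with
  | nil => exact (e_actAt k M).symm
  | cons p L ih => simp only [List.cons_append, actAt, act, ih, mul_assoc]

lemma e_mul_actAt_exchange (k l : Fin n) (L : List (Fin n × Fin n)) :
    e l * actAt k L = e k * actAt l L := by
  induction L generalizing k l with
  | nil => exact e_comm l k
  | cons p L ih =>
    simp only [actAt]
    rw [← mul_assoc, e_mul_swapAt, mul_assoc, ih, ← mul_assoc, swapAt_e,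
      ← e_actAt (swap p.1 p.2 l), ← mul_assoc, ← e_mul_swapAt, e_mul_swapAt_exchange, mul_assoc,
      e_actAt]

/-- Two lists of transpositions are equivalent when they have the same product, and the same
restriction of it to the complement of each point in the quotient monoid. -/
def ActEquiv (L M : List (Fin n × Fin n)) : Prop :=
  ∀ k, actAt k L = actAt k M ∧ act L k = act M k

instance : Trans (ActEquiv (n := n)) (ActEquiv (n := n)) (ActEquiv (n := n)) where
  trans h h' := fun k => ⟨(h k).1.trans (h' k).1, (h k).2.trans (h' k).2⟩

namespace ActEquiv

variable {L M N : List (Fin n × Fin n)}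

lemma refl (L : List (Fin n × Fin n)) : ActEquiv L L := fun _ => ⟨rfl, rfl⟩

lemma symm (h : ActEquiv L M) : ActEquiv M L := fun k => ⟨(h k).1.symm, (h k).2.symm⟩

lemma trans (h : ActEquiv L M) (h' : ActEquiv M N) : ActEquiv L N := fun k =>
  ⟨(h k).1.trans (h' k).1, (h k).2.trans (h' k).2⟩

lemma append_right (h : ActEquiv L M) (N : List (Fin n × Fin n)) :
    ActEquiv (L ++ N) (M ++ N) := fun k => by
  simp only [actAt_append, act_append, (h k).1, (h k).2, and_self]

lemma append_left (N : List (Fin n × Fin n)) (h : ActEquiv L M) :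
    ActEquiv (N ++ L) (N ++ M) := fun k => by
  simp only [actAt_append, act_append, (h _).1, (h _).2, and_self]

lemma cons (p : Fin n × Fin n) (h : ActEquiv L M) : ActEquiv (p :: L) (p :: M) :=
  h.append_left [p]

lemma diag (a : Fin n) : ActEquiv [(a, a)] [] := fun k => by
  simp [actAt, act, e_mul_self]

lemma swap_comm (a b : Fin n) : ActEquiv [(a, b)] [(b, a)] := fun k => by
  simp [actAt, act, swapAt_comm k a b, Equiv.swap_comm a b]

lemma swap_swap (a b : Fin n) : ActEquiv [(a, b), (a, b)] [] := fun k => by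
  refine ⟨?_, by simp [act]⟩
  rcases eq_or_ne a b with rfl | hab
  · simp [actAt, e_mul_self]
  simp only [actAt, Equiv.swap_apply_self]
  rcases eq_or_ne k a with rfl | ha
  · simp [swapAt_left hab, swapAt_right hab, z_z_assoc hab, e_mul_self]
  rcases eq_or_ne k b with rfl | hb
  · simp [swapAt_left hab, swapAt_right hab, z_z_assoc hab.symm, e_mul_self]
  rw [Equiv.swap_apply_of_ne_of_ne ha hb]
  nth_rw 2 [swapAt_comm]
  simp only [swapAt_of_ne hab ha hb, swapAt_of_ne hab.symm hb ha, mul_assoc, z_z_assoc ha,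
    z_z_assoc hab, z_z_assoc hb.symm, e_z_assoc, e_mul_self]

lemma braid {i j l : Fin n} (hij : i ≠ j) (hil : i ≠ l) (hjl : j ≠ l) :
    ActEquiv [(i, j), (j, l)] [(i, l), (i, j)] := fun k => by
  refine ⟨?_, by simp only [act, Equiv.swap_apply_def]; grind⟩
  simp only [actAt]
  rcases eq_or_ne k i with rfl | hi
  · simp [swapAt_left hij, swapAt_left hjl, swapAt_left hil, Equiv.swap_apply_of_ne_of_ne,
      swapAt_of_ne hij hil.symm hjl.symm, mul_assoc, z_z_assoc hil, e_z_assoc, hil.symm, hjl.symm]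
  rcases eq_or_ne k j with rfl | hj
  · simp only [Equiv.swap_apply_right, Equiv.swap_apply_of_ne_of_ne hij hil,
      Equiv.swap_apply_of_ne_of_ne hij.symm hjl, swapAt_right hij, swapAt_comm _ i l,
      swapAt_of_ne hjl hij hil, swapAt_of_ne hil.symm hjl hij.symm, mul_assoc,
      z_z_assoc hij.symm, e_z_assoc, z_z_assoc hij, z_e_assoc]
  rcases eq_or_ne k l with rfl | hl
  · simp [swapAt_left hij, swapAt_right hil, swapAt_right hjl, Equiv.swap_apply_of_ne_of_ne,
      swapAt_of_ne hij hil.symm hjl.symm, mul_assoc, z_z_assoc hjl, z_e_assoc, hil.symm, hjl.symm]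
  simp only [Equiv.swap_apply_of_ne_of_ne, hi, hj, hl, ne_eq, not_false_eq_true]
  rw [swapAt_comm k i l, swapAt_of_ne hij hi hj, swapAt_of_ne hjl hj hl,
    swapAt_of_ne hil.symm hl hi]
  have := z_square hij hi.symm hil hj.symm hjl hl
  simp only [mul_assoc, z_z_assoc (Ne.symm hj), z_z_assoc (Ne.symm hi), e_z_assoc]
  simp only [← mul_assoc] at this ⊢
  rw [this]

lemma move {p b c : Fin n} (hb : p ≠ b) (hc : p ≠ c) (hbc : b ≠ c) :
    ActEquiv [(b, c), (p, b)] [(p, c), (b, c)] :=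
  calc
    ActEquiv [(b, c), (p, b)] [(c, b), (p, b)] := (swap_comm b c).append_right [_]
    ActEquiv _ [(c, b), (b, p)] := (swap_comm p b).append_left [_]
    ActEquiv _ [(c, p), (c, b)] := braid hbc.symm hc.symm hb.symm
    ActEquiv _ [(p, c), (c, b)] := (swap_comm c p).append_right [_]
    ActEquiv _ [(p, c), (b, c)] := (swap_comm c b).append_left [_]

lemma expand {p a b : Fin n} (hb : p ≠ b) (ha : p ≠ a) (hba : b ≠ a) :
    ActEquiv [(p, a)] [(p, b), (b, a), (p, b)] :=
  calc
    ActEquiv [(p, a)] [(p, a), (p, b), (p, b)] := ((swap_swap p b).append_left [_]).symm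
    ActEquiv _ [(p, b), (b, a), (p, b)] := ((braid hb ha hba).append_right [_]).symm

lemma disjoint_comm {p a b c : Fin n} (hpa : p ≠ a) (hpb : p ≠ b) (hpc : p ≠ c) (hab : a ≠ b)
    (hac : a ≠ c) (hbc : b ≠ c) : ActEquiv [(b, c), (p, a)] [(p, a), (b, c)] :=
  calc
    ActEquiv [(b, c), (p, a)] [(b, c), (p, b), (b, a), (p, b)] :=
      (expand hpb hpa hab.symm).append_left [_]
    ActEquiv _ [(p, c), (b, c), (b, a), (p, b)] := (move hpb hpc hbc).append_right [_, _]
    ActEquiv _ [(p, c), (b, c), (a, b), (p, b)] :=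
      ((swap_comm b a).append_right [_]).append_left [_, _]
    ActEquiv _ [(p, c), (a, c), (b, c), (p, b)] :=
      ((move hab hac hbc).append_right [_]).append_left [_]
    ActEquiv _ [(p, c), (a, c), (p, c), (b, c)] := (move hpb hpc hbc).append_left [_, _]
    ActEquiv _ [(p, c), (c, a), (p, c), (b, c)] :=
      ((swap_comm a c).append_right [_, _]).append_left [_]
    ActEquiv _ [(p, a), (b, c)] := (expand hpc hpa hac.symm).symm.append_right [_]

lemma conj {p b c : Fin n} (hb : p ≠ b) (hc : p ≠ c) (hbc : b ≠ c) (a : Fin n) :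
    ActEquiv [(b, c), (p, a)] [(p, swap b c a), (b, c)] := by
  rcases eq_or_ne p a with rfl | hpa
  · rw [Equiv.swap_apply_of_ne_of_ne hb hc]
    exact ((diag p).append_left [_]).trans ((diag p).append_right [_]).symm
  rcases eq_or_ne a b with rfl | hab
  · rw [Equiv.swap_apply_left]
    exact move hb hc hbc
  rcases eq_or_ne a c with rfl | hac
  · rw [Equiv.swap_apply_right]
    exact ((swap_comm b a).append_right [_]).trans
      ((move hc hb hbc.symm).trans ((swap_comm a b).append_left [_]))
  rw [Equiv.swap_apply_of_ne_of_ne hab hac]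
  exact disjoint_comm hpa hb hc hab hac hbc

lemma append_reverse (L : List (Fin n × Fin n)) : ActEquiv (L ++ L.reverse) [] := by
  induction L with
  | nil => exact refl _
  | cons p L ih =>
    have h : ActEquiv (p :: (L ++ L.reverse ++ [p])) [p, p] :=
      (ih.append_right [p]).append_left [p]
    simpa using h.trans (swap_swap p.1 p.2)

lemma reverse_append (L : List (Fin n × Fin n)) : ActEquiv (L.reverse ++ L) [] := by
  simpa using append_reverse L.reverse

end ActEquiv

lemma act_mem {S : Finset (Fin n)} {L : List (Fin n × Fin n)}
    (hL : ∀ q ∈ L, q.1 ∈ S ∧ q.2 ∈ S) {x : Fin n} (hx : x ∈ S) : act L x ∈ S := by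
  induction L generalizing x with
  | nil => exact hx
  | cons q L ih =>
    refine ih (fun r hr => hL r (List.mem_cons_of_mem _ hr)) ?_
    have := hL q List.mem_cons_self
    rw [Equiv.swap_apply_def]
    split_ifs
    exacts [this.2, this.1, hx]

lemma exists_actEquiv_cons {S : Finset (Fin n)} {p : Fin n} (hp : p ∉ S)
    {L : List (Fin n × Fin n)} (hL : ∀ q ∈ L, q.1 ∈ insert p S ∧ q.2 ∈ insert p S) :
    ∃ a ∈ insert p S, ∃ M : List (Fin n × Fin n),
      (∀ q ∈ M, q.1 ∈ S ∧ q.2 ∈ S) ∧ ActEquiv L ((p, a) :: M) := by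
  induction L with
  | nil => exact ⟨p, Finset.mem_insert_self _ _, [], by simp, (ActEquiv.diag p).symm⟩
  | cons q L ih =>
    obtain ⟨a, ha, M, hM, hLM⟩ := ih fun r hr => hL r (List.mem_cons_of_mem _ hr)
    have key : ∀ c ∈ S, ∃ a ∈ insert p S, ∃ M : List (Fin n × Fin n),
        (∀ q ∈ M, q.1 ∈ S ∧ q.2 ∈ S) ∧ ActEquiv ((p, c) :: L) ((p, a) :: M) := by
      intro c hc
      have hpc : p ≠ c := fun h => hp (h ▸ hc)
      have h := hLM.cons (p, c)
      rcases eq_or_ne a p with rfl | hap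
      · exact ⟨c, Finset.mem_insert_of_mem hc, M, hM,
          h.trans (((ActEquiv.diag a).append_right M).cons _)⟩
      rcases eq_or_ne a c with rfl | hac
      · exact ⟨p, Finset.mem_insert_self _ _, M, hM,
          h.trans (((ActEquiv.swap_swap p a).append_right M).trans
            ((ActEquiv.diag p).append_right M).symm)⟩
      have haS := Finset.mem_of_mem_insert_of_ne ha hap
      refine ⟨a, ha, (c, a) :: M, ?_, h.trans ?_⟩
      · simpa [hc, haS] using hM
      · have h₁ : ActEquiv [(p, c), (p, a)] [(p, a), (a, c)] :=
          (ActEquiv.braid hap.symm hpc hac).symm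
        exact (h₁.append_right M).trans
          (((ActEquiv.swap_comm a c).append_right M).append_left [(p, a)])
    obtain ⟨b, c⟩ := q
    have hq := hL _ List.mem_cons_self
    rcases eq_or_ne b c with rfl | hbc
    · exact ⟨a, ha, M, hM, ((ActEquiv.diag b).append_right L).trans hLM⟩
    rcases eq_or_ne b p with rfl | hbp
    · exact key c (Finset.mem_of_mem_insert_of_ne hq.2 hbc.symm)
    have hb := Finset.mem_of_mem_insert_of_ne hq.1 hbp
    rcases eq_or_ne c p with rfl | hcp
    · obtain ⟨a', ha', M', hM', h'⟩ := key b hb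
      exact ⟨a', ha', M', hM', ((ActEquiv.swap_comm b c).append_right L).trans h'⟩
    have hc := Finset.mem_of_mem_insert_of_ne hq.2 hcp
    refine ⟨swap b c a, ?_, (b, c) :: M, ?_,
      (hLM.cons (b, c)).trans ((ActEquiv.conj hbp.symm hcp.symm hbc a).append_right M)⟩
    · rw [Equiv.swap_apply_def]
      split_ifs
      exacts [hq.2, hq.1, ha]
    · simpa [hb, hc] using hM

/-- A product of transpositions that fixes every point outside `S` is equivalent to a product of
transpositions of points of `S`. -/
lemma exists_actEquiv_of_fixed {S U : Finset (Fin n)} (hSU : Disjoint S U)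
    {L : List (Fin n × Fin n)} (hL : ∀ q ∈ L, q.1 ∈ S ∪ U ∧ q.2 ∈ S ∪ U)
    (hfix : ∀ x ∈ U, act L x = x) :
    ∃ M : List (Fin n × Fin n), (∀ q ∈ M, q.1 ∈ S ∧ q.2 ∈ S) ∧ ActEquiv L M := by
  induction U using Finset.induction_on generalizing L with
  | empty => exact ⟨L, by simpa using hL, .refl L⟩
  | insert p U hpU ih =>
    rw [Finset.disjoint_insert_right] at hSU
    have hp : p ∉ S ∪ U := by simp [hSU.1, hpU]
    obtain ⟨a, ha, M, hM, hLM⟩ :=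
      exists_actEquiv_cons hp (by simpa only [Finset.union_insert] using hL)
    have hap : a = p := by
      by_contra hap
      have h₁ : act M a = p := by
        have := (hLM p).2
        rw [hfix p (Finset.mem_insert_self _ _)] at this
        simpa [act] using this.symm
      exact hp (h₁ ▸ act_mem hM (Finset.mem_of_mem_insert_of_ne ha hap))
    subst hap
    have hLM' : ActEquiv L M := hLM.trans ((ActEquiv.diag a).append_right M)
    obtain ⟨N, hN, hMN⟩ := ih hSU.2 hM fun x hx => by
      rw [← (hLM' x).2, hfix x (Finset.mem_insert_of_mem hx)]
    exact ⟨N, hN, hLM'.trans hMN⟩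

/-- The product of the classes of the `e_i` for `i` in a list. -/
def eprod (A : List (Fin n)) : (xcon n).Quotient := (A.map e).prod

@[simp] lemma eprod_nil : eprod ([] : List (Fin n)) = 1 := rfl

@[simp] lemma eprod_cons (i : Fin n) (A : List (Fin n)) : eprod (i :: A) = e i * eprod A := by
  simp [eprod]

lemma e_mul_eprod (i : Fin n) (A : List (Fin n)) : e i * eprod A = eprod A * e i := by
  induction A with
  | nil => simp
  | cons j A ih => rw [eprod_cons, ← mul_assoc, e_comm, mul_assoc, ih, mul_assoc]

lemma eprod_mul_e {i : Fin n} {A : List (Fin n)} (h : i ∈ A) : eprod A * e i = eprod A := by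
  induction A with
  | nil => simp at h
  | cons j A ih =>
    rcases List.mem_cons.1 h with rfl | h
    · rw [← e_mul_eprod, eprod_cons, e_mul_self_assoc]
    · rw [eprod_cons, mul_assoc, ih h]

lemma eprod_mul_eprod {A B : List (Fin n)} (h : B ⊆ A) : eprod A * eprod B = eprod A := by
  induction B with
  | nil => simp
  | cons j B ih =>
    rw [List.cons_subset] at h
    rw [eprod_cons, ← mul_assoc, eprod_mul_e h.1, ih h.2]

lemma eprod_comm (A B : List (Fin n)) : eprod A * eprod B = eprod B * eprod A := by
  induction A with
  | nil => simp
  | cons j A ih => rw [eprod_cons, mul_assoc, ih, ← mul_assoc, e_mul_eprod, mul_assoc]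

lemma eprod_congr {A B : List (Fin n)} (h : ∀ x, x ∈ A ↔ x ∈ B) : eprod A = eprod B := by
  rw [← eprod_mul_eprod (fun x hx => (h x).2 hx : B ⊆ A), eprod_comm,
    eprod_mul_eprod fun x hx => (h x).1 hx]

lemma z_mul_eprod {i j : Fin n} (h : i ≠ j) (A : List (Fin n)) :
    z i j * eprod A = eprod (A.map (swap i j)) * z i j := by
  induction A with
  | nil => simp
  | cons k A ih =>
    have := e_mul_z h (swap i j k)
    rw [Equiv.swap_apply_self] at this
    rw [eprod_cons, List.map_cons, eprod_cons, ← mul_assoc, ← this, mul_assoc, ih, mul_assoc]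

lemma eprod_mul_actAt {A : List (Fin n)} {k l : Fin n} (hk : k ∈ A) (hl : l ∈ A)
    (L : List (Fin n × Fin n)) : eprod A * actAt k L = eprod A * actAt l L := by
  rw [← eprod_mul_e hl, mul_assoc, e_mul_actAt_exchange, ← mul_assoc,
    eprod_mul_e hk, eprod_mul_e hl]

lemma eprod_mul_actAt_append {A : List (Fin n)} {k : Fin n} (hk : k ∈ A)
    {P : List (Fin n × Fin n)} (hP : ∀ q ∈ P, q.1 ∈ A ∧ q.2 ∈ A) (L : List (Fin n × Fin n)) :
    eprod A * actAt k (P ++ L) = eprod A * actAt k L := by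
  induction P with
  | nil => rfl
  | cons q P ih =>
    have hP' := fun r hr => hP r (List.mem_cons_of_mem _ hr)
    obtain ⟨a, b⟩ := q
    obtain ⟨ha, hb⟩ : a ∈ A ∧ b ∈ A := hP _ List.mem_cons_self
    rw [List.cons_append, ← ih hP']
    rcases eq_or_ne a b with rfl | hab
    · simp [actAt, e_actAt]
    rw [eprod_mul_actAt hk ha, actAt, Equiv.swap_apply_left, swapAt_left hab,
      ← eprod_mul_e hb, mul_assoc, ← mul_assoc (e b), e_mul_z_right hab, mul_assoc, e_actAt,
      ← mul_assoc, eprod_mul_e ha, eprod_mul_e hb, eprod_mul_actAt hb hk]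

/-- The points where the composite partial bijection of a list is undefined. -/
def holes : List (Fin n × Fin n) → List (Fin n)
  | [] => []
  | p :: L => p.1 :: (holes L).map (swap p.1 p.2)

lemma pcomp_eq (L : List (Fin n × Fin n)) (x : Fin n) :
    pcomp L x = if x ∈ holes L then none else some (act L x) := by
  induction L generalizing x with
  | nil => simp [pcomp, holes, act]
  | cons p L ih =>
    have hnone : ∀ L : List (Fin n × Fin n),
        L.foldl (fun o p => o.bind (fbar p.1 p.2)) none = none := by
      intro L
      induction L with
      | nil => rfl
      | cons p L ih => exact ih
    have hcons : pcomp (p :: L) x = (fbar p.1 p.2 x).bind (pcomp L) := by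
      simp only [pcomp, List.foldl_cons, Option.bind_some]
      cases fbar p.1 p.2 x with
      | none => exact hnone L
      | some y => rfl
    have hmem : x ∈ (holes L).map (swap p.1 p.2) ↔ swap p.1 p.2 x ∈ holes L := by
      simp only [List.mem_map]
      exact ⟨fun ⟨y, hy, h⟩ => by rwa [← h, Equiv.swap_apply_self],
        fun h => ⟨_, h, Equiv.swap_apply_self _ _ _⟩⟩
    simp only [hcons, holes, List.mem_cons, hmem, act]
    by_cases hx : x = p.1
    · simp [fbar, hx]
    have hf : fbar p.1 p.2 x = some (swap p.1 p.2 x) := by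
      simp only [fbar, hx, if_false, Equiv.swap_apply_def]
      split_ifs <;> rfl
    rw [hf, Option.bind_some, ih]
    simp [hx]

lemma prod_z_eq (L : List (Fin n × Fin n)) (hL : L ≠ []) (hd : ∀ p ∈ L, p.1 ≠ p.2) {k : Fin n}
    (hk : k ∈ holes L) :
    (L.map fun p => z p.1 p.2).prod = eprod (holes L) * actAt k L := by
  induction L generalizing k with
  | nil => exact absurd rfl hL
  | cons p L ih =>
    have hp := hd p List.mem_cons_self
    rw [eprod_mul_actAt hk (l := p.1) List.mem_cons_self, List.map_cons, List.prod_cons, actAt,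
      Equiv.swap_apply_left, swapAt_left hp, holes]
    cases L with
    | nil => simp [holes, actAt, z_e, e_z]
    | cons q L =>
      have hq : q.1 ∈ holes (q :: L) := List.mem_cons_self
      rw [ih (List.cons_ne_nil _ _) (fun r hr => hd r (List.mem_cons_of_mem _ hr)) hq,
        ← mul_assoc, z_mul_eprod hp, mul_assoc, eprod_cons, e_mul_eprod, mul_assoc, e_z_assoc]
      have h := e_mul_z hp (swap p.1 p.2 q.1)
      rw [Equiv.swap_apply_self] at h
      rw [← z_e_assoc p.1 p.2 (actAt q.1 _), e_mul_actAt_exchange, ← mul_assoc (z _ _), ← h,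
        mul_assoc, ← mul_assoc, eprod_mul_e (List.mem_map_of_mem hq)]

lemma coe_zprod (L : List (Fin n × Fin n)) :
    ((zprod L : FreeMonoid (XA n)) : (xcon n).Quotient) = (L.map fun p => z p.1 p.2).prod := by
  induction L with
  | nil => rfl
  | cons p L ih =>
    rw [List.map_cons, List.prod_cons, ← ih]
    rfl

/-- Corollary InSn: if `u = z_{i₁j₁}⋯z_{i_sj_s}` and `v = z_{k₁l₁}⋯z_{k_tl_t}`
(with `s, t ≥ 1`) have equal associated composite partial bijections `ū = v̄`, then `u ~ v`. -/
theorem stmt7 (n : ℕ) (hn : 2 ≤ n) (L M : List (Fin n × Fin n)) (hL : L ≠ [])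
    (hM : M ≠ []) (hLd : ∀ p ∈ L, p.1 ≠ p.2) (hMd : ∀ p ∈ M, p.1 ≠ p.2)
    (h : pcomp L = pcomp M) :
    xcon n (zprod L) (zprod M) := by
  rw [← Con.eq, coe_zprod, coe_zprod]
  have hiff : ∀ x, x ∈ holes L ↔ x ∈ holes M := by
    intro x
    have := congrFun h x
    rw [pcomp_eq, pcomp_eq] at this
    by_cases h₁ : x ∈ holes L <;> by_cases h₂ : x ∈ holes M <;> simp_all
  have hact : ∀ x, x ∉ holes L → act L x = act M x := by
    intro x hx
    have := congrFun h x
    rw [pcomp_eq, pcomp_eq, if_neg hx, if_neg (mt (hiff x).2 hx)] at this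
    exact Option.some.inj this
  obtain ⟨k, hk⟩ : ∃ k, k ∈ holes L := by
    cases L with
    | nil => exact absurd rfl hL
    | cons p L => exact ⟨p.1, List.mem_cons_self⟩
  rw [prod_z_eq L hL hLd hk, prod_z_eq M hM hMd ((hiff k).1 hk), ← eprod_congr hiff]
  obtain ⟨P, hP, hLP⟩ := exists_actEquiv_of_fixed (L := L ++ M.reverse)
    (disjoint_compl_right (a := (holes L).toFinset))
    (fun q _ => by simp) (fun x hx => by
      rw [act_append, hact x (by simpa using hx), ← act_append, (ActEquiv.append_reverse M x).2,
        act])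
  have hLPM : ActEquiv L (P ++ M) := by
    have h₁ := (ActEquiv.reverse_append M).append_left L
    rw [List.append_nil, ← List.append_assoc] at h₁
    exact h₁.symm.trans (hLP.append_right M)
  rw [(hLPM k).1, eprod_mul_actAt_append hk (fun q hq => by simpa using hP q hq)]
end PaperFormal
end

section
/- For all 1 ≤ i < j ≤ n and 1 ≤ k ≤ n−1, the word s_k τ_{ij} s_k is ≈-equivalent to τ_{σ_k(i), σ_k(j)}, where σ_k is the transposition of {1,…,n} interchanging k and k+1 (here τ is indexed symmetrically, so τ_{ab} = τ_{ba}). -/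
namespace PaperFormal


/-- The alphabet `Y`: letters `s_1,…,s_{n-1}` (the letter `s i` for `i : Fin (n-1)`
represents `s_{i+1}`, i.e. indices are 0-based), `e` and `t`. -/
inductive YA (n : ℕ) : Type where
  | s (i : Fin (n - 1))
  | e
  | t

/-- The one-letter word `s_{i+1}` (0-based index `i`). -/
def S {n : ℕ} (i : Fin (n - 1)) : FreeMonoid (YA n) := FreeMonoid.of (YA.s i)

/-- The one-letter word `e`. -/
def Ew {n : ℕ} : FreeMonoid (YA n) := FreeMonoid.of YA.e

/-- The one-letter word `t`. -/
def Tw {n : ℕ} : FreeMonoid (YA n) := FreeMonoid.of YA.t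

/-- The defining relations (R11)–(R21), with 0-based indexing of the `s i`
(so the paper's `s_1` is `S i` with `i.val = 0`, etc.). -/
inductive YRel {n : ℕ} : FreeMonoid (YA n) → FreeMonoid (YA n) → Prop
  | r11 (i) : YRel (S i * S i) 1
  | r12 (i j : Fin (n - 1)) (h : i.val + 1 < j.val ∨ j.val + 1 < i.val) :
      YRel (S i * S j) (S j * S i)
  | r13 (i j : Fin (n - 1)) (h : i.val + 1 = j.val ∨ j.val + 1 = i.val) :
      YRel (S i * S j * S i) (S j * S i * S j)
  | r14a : YRel (Ew * Ew) Ew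
  | r14b : YRel (Ew * Tw * Ew) Ew
  | r15a : YRel (Tw * Tw) Tw
  | r15b : YRel (Tw * Ew * Tw) Tw
  | r15c (i) (h : i.val = 0) : YRel (Tw * S i) Tw
  | r15d (i) (h : i.val = 0) : YRel (S i * Tw) Tw
  | r16 (i) (h : 1 ≤ i.val) : YRel (Ew * S i) (S i * Ew)
  | r17 (i) (h : 2 ≤ i.val) : YRel (Tw * S i) (S i * Tw)
  | r18a (a) (ha : a.val = 0) : YRel (S a * Ew * S a * Ew) Ew
  | r18b (a) (ha : a.val = 0) : YRel (S a * Ew * S a) (Ew * S a * Ew)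
  | r19 (b) (hb : b.val = 1) : YRel (Tw * S b * Tw * S b) (S b * Tw * S b * Tw)
  | r20 (a b c) (ha : a.val = 0) (hb : b.val = 1) (hc : c.val = 2) :
      YRel (Tw * (S b * S c * S a * S b) * Tw * (S b * S c * S a * S b))
           (S b * S c * S a * S b * Tw * (S b * S c * S a * S b) * Tw)
  | r21 (a b) (ha : a.val = 0) (hb : b.val = 1) :
      YRel (Tw * (S b * S a * Ew * S a * S b)) (S b * S a * Ew * S a * S b * Tw)

/-- The congruence `≈` on the free monoid `Y*` generated by relations (R11)–(R21). -/
def ycon (n : ℕ) : Con (FreeMonoid (YA n)) := conGen YRel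

/-- The word `s_{i₁}⋯s_{i_k}` over the letters `s`. -/
def sprod {n : ℕ} (L : List (Fin (n - 1))) : FreeMonoid (YA n) := (L.map S).prod

/-- The (0-based) list of indices of `c_r = s_1 s_2 ⋯ s_{r-1}`. -/
def cIdx (n : ℕ) (r : Fin n) : List (Fin (n - 1)) :=
  (List.finRange (n - 1)).filter (fun k => k.val < r.val)

/-- The word `c_r = s_1 s_2 ⋯ s_{r-1}`. -/
def cw {n : ℕ} (r : Fin n) : FreeMonoid (YA n) := sprod (cIdx n r)

/-- The word `c_r⁻¹ = s_{r-1} ⋯ s_2 s_1`. -/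
def cwInv {n : ℕ} (r : Fin n) : FreeMonoid (YA n) := sprod (cIdx n r).reverse

/-- The word `ε_r = c_r⁻¹ e c_r`. -/
def eps {n : ℕ} (r : Fin n) : FreeMonoid (YA n) := cwInv r * Ew * cw r

/-- The word `τ_{ij} = τ_{ji} = c_i⁻¹ c_j⁻¹ t c_j c_i` (for `i < j`), indexed symmetrically. -/
def tauw {n : ℕ} (i j : Fin n) : FreeMonoid (YA n) :=
  cwInv (min i j) * cwInv (max i j) * Tw * cw (max i j) * cw (min i j)

/-- The transposition `σ_k` of `{1,…,n}` interchanging `k` and `k+1`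
(0-based: `sigma n k` swaps the elements of `Fin n` with values `k.val` and `k.val + 1`). -/
def sigma (n : ℕ) (k : Fin (n - 1)) (r : Fin n) : Fin n :=
  if r.val = k.val then ⟨k.val + 1, by have := k.isLt; omega⟩
  else if r.val = k.val + 1 then ⟨k.val, by have := k.isLt; omega⟩
  else r

section Group

variable {G : Type*} [Group G]

/-- The product `s 0 * s 1 * ⋯ * s (r - 1)`. -/
def initProd (s : ℕ → G) (r : ℕ) : G := ((List.range r).map s).prod

@[simp]
lemma initProd_zero (s : ℕ → G) : initProd s 0 = 1 := rfl

lemma initProd_succ (s : ℕ → G) (r : ℕ) : initProd s (r + 1) = initProd s r * s r := by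
  simp [initProd, List.range_succ]

/-- The Coxeter relations of the symmetric group on `s 0, …, s (N - 1)`. -/
structure CoxeterA (N : ℕ) (s : ℕ → G) : Prop where
  sq : ∀ a < N, s a * s a = 1
  comm : ∀ a b, b < N → a + 1 < b → s a * s b = s b * s a
  braid : ∀ a, a + 1 < N → s a * s (a + 1) * s a = s (a + 1) * s a * s (a + 1)

namespace CoxeterA

variable {N : ℕ} {s : ℕ → G}

lemma initProd_succ_mul (hs : CoxeterA N s) {r : ℕ} (hr : r < N) :
    initProd s (r + 1) * s r = initProd s r := by
  rw [initProd_succ, mul_assoc, hs.sq r hr, mul_one]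

lemma initProd_mul_of_lt (hs : CoxeterA N s) {r k : ℕ} (hk : k < N) (h : r < k) :
    initProd s r * s k = s k * initProd s r := by
  induction r with
  | zero => simp
  | succ r ih =>
    rw [initProd_succ, mul_assoc, hs.comm r k hk h, ← mul_assoc, ih (by omega), mul_assoc]

lemma initProd_mul_of_add_one_lt (hs : CoxeterA N s) {r k : ℕ} (hr : r ≤ N) (h : k + 1 < r) :
    initProd s r * s k = s (k + 1) * initProd s r := by
  induction r, h using Nat.le_induction with
  | base =>
    simp only [initProd_succ]
    rw [mul_assoc, mul_assoc, ← mul_assoc (s k), hs.braid k (by omega), ← mul_assoc, ← mul_assoc,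
      hs.initProd_mul_of_lt (by omega) (by omega)]
    simp only [mul_assoc]
  | succ r h ih =>
    rw [initProd_succ, mul_assoc, ← hs.comm k r (by omega) (by omega), ← mul_assoc,
      ih (by omega), mul_assoc]

lemma initProd_succ_mul_self (hs : CoxeterA N s) {r : ℕ} (hr : r < N) :
    initProd s (r + 1) * initProd s (r + 1) = s 0 * (initProd s (r + 1) * initProd s r) := by
  induction r with
  | zero => simp [initProd_succ]
  | succ r ih =>
    have hcomm : initProd s (r + 2) * initProd s (r + 1) =
        initProd s (r + 1) * initProd s r * s (r + 1) * s r := by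
      rw [initProd_succ s (r + 1), mul_assoc, initProd_succ s r, ← mul_assoc (s (r + 1)),
        ← hs.initProd_mul_of_lt hr (Nat.lt_succ_self r)]
      simp only [mul_assoc]
    have hbraid := hs.braid r hr
    calc initProd s (r + 2) * initProd s (r + 2)
        = initProd s (r + 2) * initProd s (r + 1) * s (r + 1) := by
          rw [mul_assoc, ← initProd_succ]
      _ = initProd s (r + 1) * initProd s r * (s r * s (r + 1) * s r) := by
          rw [hcomm, hbraid]; simp only [mul_assoc]
      _ = initProd s (r + 1) * initProd s (r + 1) * s (r + 1) * s r := by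
          rw [initProd_succ s r]; simp only [mul_assoc]
      _ = s 0 * (initProd s (r + 2) * initProd s (r + 1)) := by
          rw [ih (by omega), hcomm]; simp only [mul_assoc]

/-- Right multiplication by `s k` acts on the coset representatives `initProd s b * initProd s a`
of the subgroup generated by `s 0, s 2, s 3, …` through the transposition `(k, k + 1)`. -/
lemma exists_initProd_mul_eq (hs : CoxeterA N s) {a b k : ℕ} (hab : a < b) (hb : b ≤ N)
    (hk : k < N) :
    ∃ u, (u = 1 ∨ ∃ m < N, m ≠ 1 ∧ u = s m) ∧
      initProd s b * initProd s a * s k =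
        u * (initProd s (max (Equiv.swap k (k + 1) a) (Equiv.swap k (k + 1) b)) *
          initProd s (min (Equiv.swap k (k + 1) a) (Equiv.swap k (k + 1) b))) := by
  rcases lt_trichotomy k a with hka | rfl | hka
  · have hkb : Equiv.swap k (k + 1) b = b :=
      Equiv.swap_apply_of_ne_of_ne (by omega) (by omega)
    rcases Nat.lt_or_ge (k + 1) a with h | h
    · refine ⟨s (k + 2), .inr ⟨k + 2, by omega, by omega, rfl⟩, ?_⟩
      rw [hkb, Equiv.swap_apply_of_ne_of_ne (by omega) (by omega), max_eq_right hab.le,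
        min_eq_left hab.le, mul_assoc, hs.initProd_mul_of_add_one_lt (by omega) h, ← mul_assoc,
        hs.initProd_mul_of_add_one_lt hb (by omega), mul_assoc]
    · obtain rfl : a = k + 1 := by omega
      refine ⟨1, .inl rfl, ?_⟩
      rw [hkb, Equiv.swap_apply_right, max_eq_right (by omega), min_eq_left (by omega), mul_assoc,
        hs.initProd_succ_mul hk, one_mul]
  · rcases Nat.lt_or_ge (k + 1) b with h | h
    · refine ⟨1, .inl rfl, ?_⟩
      rw [Equiv.swap_apply_left, Equiv.swap_apply_of_ne_of_ne (by omega) (by omega),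
        max_eq_right (by omega), min_eq_left (by omega), mul_assoc, ← initProd_succ, one_mul]
    · obtain rfl : b = k + 1 := by omega
      refine ⟨s 0, .inr ⟨0, by omega, by omega, rfl⟩, ?_⟩
      rw [Equiv.swap_apply_left, Equiv.swap_apply_right, max_eq_left (by omega),
        min_eq_right (by omega), mul_assoc, ← initProd_succ, hs.initProd_succ_mul_self hk]
  · rw [mul_assoc, hs.initProd_mul_of_lt hk hka, ← mul_assoc,
      Equiv.swap_apply_of_ne_of_ne (show a ≠ k by omega) (by omega)]
    rcases lt_trichotomy k b with hkb | rfl | hkb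
    · rcases Nat.lt_or_ge (k + 1) b with h | h
      · refine ⟨s (k + 1), .inr ⟨k + 1, by omega, by omega, rfl⟩, ?_⟩
        rw [Equiv.swap_apply_of_ne_of_ne (by omega) (by omega), max_eq_right hab.le,
          min_eq_left hab.le, hs.initProd_mul_of_add_one_lt hb h, mul_assoc]
      · obtain rfl : b = k + 1 := by omega
        refine ⟨1, .inl rfl, ?_⟩
        rw [Equiv.swap_apply_right, max_eq_right hka.le, min_eq_left hka.le,
          hs.initProd_succ_mul hk, one_mul]
    · refine ⟨1, .inl rfl, ?_⟩
      rw [Equiv.swap_apply_left, max_eq_right (by omega), min_eq_left (by omega), ← initProd_succ,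
        one_mul]
    · refine ⟨s k, .inr ⟨k, hk, by omega, rfl⟩, ?_⟩
      rw [Equiv.swap_apply_of_ne_of_ne (by omega) (by omega), max_eq_right hab.le,
        min_eq_left hab.le, hs.initProd_mul_of_lt hk hkb, mul_assoc]

end CoxeterA

end Group

section Quotient

variable {n : ℕ}

lemma mk_eq_of_yRel {x y : FreeMonoid (YA n)} (h : YRel x y) : (ycon n).mk' x = (ycon n).mk' y :=
  (Con.eq _).2 (ConGen.Rel.of _ _ h)

/-- The class of `S k` in the quotient monoid, as a unit; it is `1` when `k` is out of range. -/
def sUnit (n k : ℕ) : ((ycon n).Quotient)ˣ :=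
  if h : k < n - 1 then
    ⟨(ycon n).mk' (S ⟨k, h⟩), (ycon n).mk' (S ⟨k, h⟩), mk_eq_of_yRel (.r11 _),
      mk_eq_of_yRel (.r11 _)⟩
  else 1

lemma coe_sUnit (k : Fin (n - 1)) : (sUnit n k : (ycon n).Quotient) = (ycon n).mk' (S k) := by
  simp [sUnit]

lemma sUnit_inv (k : ℕ) : (sUnit n k)⁻¹ = sUnit n k := by
  unfold sUnit
  split_ifs
  · rfl
  · simp

lemma coxeterA_sUnit : CoxeterA (n - 1) (sUnit n) where
  sq a _ := by rw [← sUnit_inv, mul_inv_eq_one, sUnit_inv]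
  comm a b hb hab := by
    have := mk_eq_of_yRel (.r12 (n := n) ⟨a, by omega⟩ ⟨b, hb⟩ (.inl hab))
    simpa only [map_mul, ← coe_sUnit, ← Units.val_mul, Units.val_inj] using this
  braid a ha := by
    have := mk_eq_of_yRel (.r13 (n := n) ⟨a, by omega⟩ ⟨a + 1, ha⟩ (.inl rfl))
    simpa only [map_mul, ← coe_sUnit, ← Units.val_mul, Units.val_inj] using this

lemma mk_sprod (L : List (Fin (n - 1))) :
    (ycon n).mk' (sprod L) =
      ((L.map fun k : Fin (n - 1) => sUnit n k).prod : ((ycon n).Quotient)ˣ) := by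
  induction L with
  | nil => rfl
  | cons k L ih =>
    simp only [sprod, List.map_cons, List.prod_cons, map_mul, Units.val_mul, coe_sUnit] at ih ⊢
    rw [ih]

lemma map_val_cIdx (r : Fin n) : (cIdx n r).map Fin.val = List.range r := by
  have h : (cIdx n r).map Fin.val = (List.range (n - 1)).filter (· < r.val) := by
    rw [← List.map_coe_finRange_eq_range, List.filter_map]
    rfl
  rw [h]
  obtain ⟨m, hm⟩ : ∃ m, n - 1 = r + m := ⟨n - 1 - r, by omega⟩
  rw [hm, List.range_add, List.filter_append, List.filter_eq_self.2 (by simp),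
    List.filter_eq_nil_iff.2 (by simp), List.append_nil]

lemma map_sUnit_cIdx (r : Fin n) :
    (cIdx n r).map (fun k : Fin (n - 1) => sUnit n k) = (List.range r).map (sUnit n) := by
  rw [← map_val_cIdx, List.map_map]
  rfl

lemma mk_cw (r : Fin n) : (ycon n).mk' (cw r) = (initProd (sUnit n) r : ((ycon n).Quotient)ˣ) := by
  rw [cw, mk_sprod, map_sUnit_cIdx, initProd]

lemma mk_cwInv (r : Fin n) :
    (ycon n).mk' (cwInv r) = ((initProd (sUnit n) r)⁻¹ : ((ycon n).Quotient)ˣ) := by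
  rw [cwInv, mk_sprod, List.map_reverse, map_sUnit_cIdx, initProd, List.prod_inv_reverse,
    List.map_map]
  simp only [Function.comp_def, sUnit_inv]

lemma mk_tauw (i j : Fin n) :
    (ycon n).mk' (tauw i j) =
      ((initProd (sUnit n) (max i.val j) * initProd (sUnit n) (min i.val j))⁻¹ :
          ((ycon n).Quotient)ˣ) * (ycon n).mk' Tw *
        (initProd (sUnit n) (max i.val j) * initProd (sUnit n) (min i.val j) :
          ((ycon n).Quotient)ˣ) := by
  simp only [tauw, map_mul, mk_cw, mk_cwInv, mul_inv_rev, Units.val_mul, Fin.coe_max, Fin.coe_min,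
    mul_assoc]

lemma sUnit_inv_mul_mk_Tw_mul {m : ℕ} (hm : m < n - 1) (h1 : m ≠ 1) :
    ((sUnit n m)⁻¹ : ((ycon n).Quotient)ˣ) * (ycon n).mk' Tw * (sUnit n m) = (ycon n).mk' Tw := by
  have hcomm : (ycon n).mk' Tw * sUnit n m = sUnit n m * (ycon n).mk' Tw := by
    have hS := coe_sUnit (n := n) ⟨m, hm⟩
    rw [hS, ← map_mul, ← map_mul]
    rcases Nat.eq_zero_or_pos m with h0 | h0
    · rw [mk_eq_of_yRel (.r15c _ h0), mk_eq_of_yRel (.r15d _ h0)]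
    · exact mk_eq_of_yRel (.r17 _ (show 2 ≤ m by omega))
  rw [mul_assoc, hcomm, Units.inv_mul_cancel_left]

lemma sigma_val (k : Fin (n - 1)) (r : Fin n) :
    (sigma n k r).val = Equiv.swap k.val (k + 1) r := by
  rw [sigma, Equiv.swap_apply_def]
  split_ifs <;> rfl

end Quotient

/-- Lemma sts: for `1 ≤ i < j ≤ n` and `1 ≤ k ≤ n-1` (0-based here),
`s_k τ_{ij} s_k ≈ τ_{σ_k(i), σ_k(j)}`, where `σ_k` interchanges `k` and `k+1`
(`τ` is indexed symmetrically). -/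
theorem stmt11 (n : ℕ) (hn : 2 ≤ n) (i j : Fin n) (hij : i < j) (k : Fin (n - 1)) :
    ycon n (S k * tauw i j * S k) (tauw (sigma n k i) (sigma n k j)) := by
  refine (Con.eq _).1 ?_
  change (ycon n).mk' _ = (ycon n).mk' _
  obtain ⟨u, hu, heq⟩ := coxeterA_sUnit.exists_initProd_mul_eq (show i.val < j from hij)
    (show j.val ≤ n - 1 by omega) k.isLt
  have hTu : ((u⁻¹ : ((ycon n).Quotient)ˣ) : (ycon n).Quotient) * (ycon n).mk' Tw * u =
      (ycon n).mk' Tw := by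
    rcases hu with rfl | ⟨m, hm, h1, rfl⟩
    · simp
    · exact sUnit_inv_mul_mk_Tw_mul hm h1
  rw [map_mul, map_mul, mk_tauw, mk_tauw, sigma_val, sigma_val, ← coe_sUnit,
    max_eq_right (show i.val ≤ j from hij.le), min_eq_left (show i.val ≤ j from hij.le)]
  set g := initProd (sUnit n) j * initProd (sUnit n) i
  set g' := initProd (sUnit n) (max _ _) * initProd (sUnit n) (min _ _)
  calc (sUnit n k : (ycon n).Quotient) * ((g⁻¹ : ((ycon n).Quotient)ˣ) * (ycon n).mk' Tw * g) *
        sUnit n k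
      = ((g * sUnit n k)⁻¹ : ((ycon n).Quotient)ˣ) * (ycon n).mk' Tw *
          (g * sUnit n k : ((ycon n).Quotient)ˣ) := by
        simp only [mul_inv_rev, sUnit_inv, Units.val_mul, mul_assoc]
    _ = (g'⁻¹ : ((ycon n).Quotient)ˣ) *
          ((u⁻¹ : ((ycon n).Quotient)ˣ) * (ycon n).mk' Tw * u) * g' := by
        rw [heq]
        simp only [mul_inv_rev, Units.val_mul, mul_assoc]
    _ = (g'⁻¹ : ((ycon n).Quotient)ˣ) * (ycon n).mk' Tw * g' := by rw [hTu]
end PaperFormal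
end
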